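/- (Polynomial structure of 1-part simple Hurwitz numbers) For integers d ≥ 1 and m ≥ 0, let N(d, m) be the number of m-tuples (τ₁, …, τ_m) of transpositions in S_d with τ₁∘τ₂∘⋯∘τ_m = (1 2 … d), and for g ≥ 0 define h_g(d) = N(d, d+2g−1)/(d+2g−1)!. Then for every integer g ≥ 1 there exists a polynomial p_g ∈ ℚ[x] of degree 3g−1 such that h_g(d) = (d^d/d!)·p_g(d) for all integers d ≥ 1. -/

import Mathlib

/-- `Nfact d m` is the number of `m`-tuples `(τ₁, …, τ_m)` of transpositions in the
symmetric group on `d` letters with `τ₁ ∘ τ₂ ∘ ⋯ ∘ τ_m` equal to the standard `d`-cycle. -/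
noncomputable def Nfact (d m : ℕ) : ℕ :=
  Nat.card {τ : Fin m → Equiv.Perm (Fin d) //
    (∀ i, (τ i).IsSwap) ∧ (List.ofFn τ).prod = finRotate d}

/-- The 1-part simple Hurwitz number `h_g(d) = N(d, d+2g−1)/(d+2g−1)!`. -/
noncomputable def hurwitz (g d : ℕ) : ℚ :=
  (Nfact d (d + 2 * g - 1) : ℚ) / ((d + 2 * g - 1).factorial : ℚ)

open Polynomial Matrix Equiv Finset

theorem Matrix.derivative_det {n R : Type*} [Fintype n] [DecidableEq n] [CommRing R]
    (M : Matrix n n R[X]) :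
    derivative M.det = (M.adjugate * M.map derivative).trace := by
  have key (k : n) : (M.adjugate * M.map derivative) k k
      = (M.updateCol k fun i => derivative (M i k)).det := by
    rw [← cramer_apply, cramer_eq_adjugate_mulVec]
    rfl
  simp only [trace, diag_apply, key, det_apply]
  rw [derivative_sum, Finset.sum_comm]
  refine Finset.sum_congr rfl fun π _ => ?_
  rw [← Finset.smul_sum, Units.smul_def, derivative_smul, derivative_prod_finset]
  congr 1
  refine Finset.sum_congr rfl fun k _ => ?_
  rw [← Finset.prod_erase_mul _ _ (Finset.mem_univ k), updateCol_self]
  congr 1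
  refine Finset.prod_congr rfl fun i hi => ?_
  rw [updateCol_ne (Finset.ne_of_mem_erase hi)]

theorem Matrix.det_add_vecMulVec {n R : Type*} [Fintype n] [DecidableEq n] [CommRing R]
    [IsDomain R] {A : Matrix n n R} (hA : A.det ≠ 0) (u v : n → R) :
    (A + vecMulVec u v).det = A.det + v ⬝ᵥ (A.adjugate *ᵥ u) := by
  set φ := algebraMap R (FractionRing R)
  apply IsFractionRing.injective R (FractionRing R)
  have hdet : (φ.mapMatrix A).det = φ A.det := (φ.map_det A).symm
  have hu : IsUnit (φ.mapMatrix A).det := by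
    rw [hdet, isUnit_iff_ne_zero]
    exact fun h => hA (IsFractionRing.injective R (FractionRing R) (by rw [h, map_zero]))
  have h := det_add_replicateCol_mul_replicateRow (ι := Unit) hu (φ ∘ u) (φ ∘ v)
  have e1 : φ.mapMatrix A + replicateCol Unit (φ ∘ u) * replicateRow Unit (φ ∘ v)
      = φ.mapMatrix (A + vecMulVec u v) := by
    rw [← vecMulVec_eq, map_add]
    congr 1
    ext i j
    simp [vecMulVec_apply]
  rw [e1, ← RingHom.map_det] at h
  change φ _ = φ _
  rw [h, det_unique (n := Unit), add_apply, one_apply_eq, mul_add, mul_one, map_add, hdet]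
  congr 1
  rw [inv_def, hdet, Ring.inverse_eq_inv']
  have h0 : φ A.det ≠ 0 := by rw [← hdet]; exact hu.ne_zero
  have e2 : (replicateRow Unit (φ ∘ v) * ((φ A.det)⁻¹ • (φ.mapMatrix A).adjugate) *
      replicateCol Unit (φ ∘ u)) default default
      = (φ A.det)⁻¹ * ((φ ∘ v) ⬝ᵥ ((φ.mapMatrix A).adjugate *ᵥ (φ ∘ u))) := by
    rw [Matrix.mul_assoc, Matrix.smul_mul, Matrix.mul_smul, smul_apply, smul_eq_mul]
    rfl
  rw [e2, mul_inv_cancel_left₀ h0, ← RingHom.map_adjugate, RingHom.map_dotProduct]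
  congr 1
  ext i
  simp [RingHom.map_mulVec]

theorem Matrix.dvd_det_of_row_sum {n R : Type*} [Fintype n] [DecidableEq n] [CommRing R]
    [Nonempty n] (A : Matrix n n R) (s : R) (h : ∀ i, ∑ j, A i j = s) : s ∣ A.det := by
  have h1 : A *ᵥ 1 = s • 1 := by ext i; simp [mulVec, dotProduct, h]
  have h2 : A.det • (1 : n → R) = s • (A.adjugate *ᵥ 1) := by
    rw [← mulVec_smul, ← h1, mulVec_mulVec, adjugate_mul, smul_mulVec, one_mulVec]
  obtain ⟨i⟩ := ‹Nonempty n›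
  exact ⟨(A.adjugate *ᵥ 1) i, by simpa using congrFun h2 i⟩

instance Equiv.Perm.decidableIsSwap {n : Type*} [Fintype n] [DecidableEq n] :
    DecidablePred (IsSwap : Perm n → Prop) :=
  fun _ => decidable_of_iff _ Perm.card_support_eq_two

theorem Equiv.Perm.sum_swap {n M : Type*} [Fintype n] [DecidableEq n] [AddCommGroup M]
    (f : Perm n → M) :
    ∑ i, ∑ j, f (swap i j) = Fintype.card n • f 1 + 2 • ∑ τ : {τ : Perm n // τ.IsSwap}, f τ := by
  rw [← Fintype.sum_prod_type' (f := fun i j => f (swap i j)),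
    ← Finset.sum_filter_add_sum_filter_not _ (fun p : n × n => p.1 = p.2)]
  congr 1
  · rw [← Finset.card_univ, ← Finset.sum_const]
    symm
    refine Finset.sum_bij (fun i _ => (i, i)) (by simp) (by simp) ?_ ?_
    · rintro ⟨i, j⟩ h
      simp at h
      exact ⟨i, by simp, by simp [h]⟩
    · simp [Perm.one_def]
  · rw [Finset.smul_sum]
    rw [← Finset.sum_subtype (univ.filter fun τ : Perm n => τ.IsSwap) (by simp) (fun τ => 2 • f τ)]
    rw [← Finset.sum_fiberwise_of_maps_to (g := fun p : n × n => swap p.1 p.2)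
      (t := univ.filter fun τ : Perm n => τ.IsSwap)]
    · refine Finset.sum_congr rfl fun τ hτ => ?_
      obtain ⟨a, b, hab, rfl⟩ := (Finset.mem_filter.1 hτ).2
      have : ((univ.filter fun p : n × n => ¬ p.1 = p.2).filter
          fun p => swap p.1 p.2 = swap a b) = {(a, b), (b, a)} := by
        ext ⟨i, j⟩
        simp only [mem_filter, mem_univ, true_and, mem_insert, mem_singleton, Prod.mk.injEq]
        constructor
        · rintro ⟨hij, h⟩
          have h1 : swap a b i = j := by rw [← h, swap_apply_left]
          have h2 : i = a ∨ i = b := eq_or_eq_of_swap_apply_ne_self (by rw [h1]; exact Ne.symm hij)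
          rcases h2 with rfl | rfl
          · simp_all
          · simp_all
        · rintro (⟨rfl, rfl⟩ | ⟨rfl, rfl⟩)
          · exact ⟨hab, rfl⟩
          · exact ⟨Ne.symm hab, swap_comm _ _⟩
      rw [this, Finset.sum_pair (by simp [hab]), swap_comm b a, two_smul]
    · rintro ⟨i, j⟩ h
      simp at h ⊢
      exact ⟨i, j, h, rfl⟩

namespace Equiv.Perm

variable {n : Type*} [DecidableEq n]

/-- The matrix `1 - X P_σ`, where `P_σ` is the permutation matrix of `σ`. -/
noncomputable def cycleMatrix (σ : Perm n) : Matrix n n ℚ[X] := 1 - (X : ℚ[X]) • σ.permMatrix ℚ[X]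

theorem cycleMatrix_apply (σ : Perm n) (i j : n) :
    σ.cycleMatrix i j = (if i = j then 1 else 0) - if σ i = j then X else 0 := by
  simp [cycleMatrix, Matrix.one_apply, PEquiv.toMatrix_apply, toPEquiv_apply, eq_comm]

variable [Fintype n]

/-- The polynomial `det (1 - X P_σ)`, which is the product of `1 - X ^ l` over the lengths `l` of
the cycles of `σ`, fixed points included. -/
noncomputable def cyclePoly (σ : Perm n) : ℚ[X] := σ.cycleMatrix.det

theorem cyclePoly_ne_zero (σ : Perm n) : σ.cyclePoly ≠ 0 := by
  intro h
  have h1 : (evalRingHom (0 : ℚ)) σ.cyclePoly = 1 := by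
    rw [cyclePoly, RingHom.map_det]
    convert det_one (n := n) (R := ℚ)
    ext i j
    simp only [RingHom.mapMatrix_apply, map_apply, cycleMatrix_apply, Matrix.one_apply]
    split_ifs <;> simp
  rw [h] at h1
  simp at h1

theorem one_sub_X_dvd_cyclePoly [Nonempty n] (σ : Perm n) : 1 - X ∣ σ.cyclePoly :=
  dvd_det_of_row_sum _ _ fun i => by
    simp [cycleMatrix_apply, Finset.sum_sub_distrib]

theorem cyclePoly_one : (1 : Perm n).cyclePoly = (1 - X) ^ Fintype.card n := by
  have : (1 : Perm n).cycleMatrix = (1 - X : ℚ[X]) • (1 : Matrix n n ℚ[X]) := by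
    rw [cycleMatrix, permMatrix_one, sub_smul, one_smul]
  rw [cyclePoly, this, det_smul, det_one, mul_one]

theorem cyclePoly_swap_mul (σ : Perm n) (i j : n) :
    (swap i j * σ).cyclePoly = σ.cyclePoly +
      (Pi.single i 1 - Pi.single j 1) ⬝ᵥ (σ.cycleMatrix.adjugate *ᵥ
        ((X : ℚ[X]) • (σ.permMatrix ℚ[X] *ᵥ (Pi.single i 1 - Pi.single j 1)))) := by
  rw [cyclePoly, cyclePoly, ← det_add_vecMulVec σ.cyclePoly_ne_zero]
  congr 1
  refine Matrix.ext fun a b => ?_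
  rw [Matrix.add_apply, cycleMatrix_apply, cycleMatrix_apply, vecMulVec_apply, permMatrix_mulVec]
  simp only [Pi.smul_apply, Function.comp, Pi.sub_apply, Pi.single_apply, smul_eq_mul,
    coe_mul, swap_apply_def]
  grind

theorem sum_cyclePoly_swap_mul [Nonempty n] (σ : Perm n) :
    (1 - X) * ∑ i, ∑ j, (swap i j * σ).cyclePoly =
      (1 - X) * ((Fintype.card n : ℚ[X]) ^ 2 * σ.cyclePoly
        - 2 * (Fintype.card n : ℚ[X]) * X * derivative σ.cyclePoly)
      - 2 * X * (Fintype.card n : ℚ[X]) * σ.cyclePoly := by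
  set B := σ.cycleMatrix.adjugate * σ.permMatrix ℚ[X] with hB
  have h1 (i j : n) : (swap i j * σ).cyclePoly
      = σ.cyclePoly + X * (B i i + B j j - B i j - B j i) := by
    rw [cyclePoly_swap_mul, mulVec_smul, mulVec_mulVec, ← hB, dotProduct_smul, mulVec_sub,
      sub_dotProduct, dotProduct_sub, dotProduct_sub]
    simp only [mulVec_single_one, single_one_dotProduct, col_apply, smul_eq_mul]
    ring
  have htr : derivative σ.cyclePoly = - ∑ i, B i i := by
    rw [cyclePoly, derivative_det]
    have : σ.cycleMatrix.map derivative = - σ.permMatrix ℚ[X] := by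
      ext i j : 1
      rw [map_apply, cycleMatrix_apply]
      simp only [Matrix.neg_apply, PEquiv.toMatrix_apply, toPEquiv_apply, Option.mem_some_iff]
      split_ifs <;> simp_all
    rw [this, Matrix.mul_neg, trace_neg]
    rfl
  have hsum : (1 - X) * ∑ i, ∑ j, B i j = (Fintype.card n : ℚ[X]) * σ.cyclePoly := by
    have e1 : σ.cycleMatrix *ᵥ 1 = (1 - X : ℚ[X]) • 1 := by
      rw [cycleMatrix, sub_mulVec, one_mulVec, smul_mulVec, permMatrix_mulVec, sub_smul, one_smul]
      rfl
    have e2 : σ.cyclePoly • (1 : n → ℚ[X]) = (1 - X : ℚ[X]) • (B *ᵥ 1) := by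
      have : B *ᵥ (1 : n → ℚ[X]) = σ.cycleMatrix.adjugate *ᵥ 1 := by
        rw [hB, ← mulVec_mulVec, permMatrix_mulVec]; rfl
      rw [this, ← mulVec_smul, ← e1, mulVec_mulVec, adjugate_mul, smul_mulVec, one_mulVec]
      rfl
    have e3 (i : n) : (1 - X) * ∑ j, B i j = σ.cyclePoly := by
      simpa [mulVec, dotProduct] using (congrFun e2 i).symm
    rw [Finset.mul_sum]
    simp [e3]
  have hsum' : ∑ i, ∑ j, B j i = ∑ i, ∑ j, B i j := Finset.sum_comm
  simp only [h1, Finset.sum_add_distrib, ← Finset.mul_sum, Finset.sum_sub_distrib,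
    Finset.sum_const, Finset.card_univ, nsmul_eq_mul, hsum', htr]
  linear_combination -2 * X * hsum

/-- The quotient of `det (1 - X P_σ)` by `1 - X`. -/
noncomputable def reducedCyclePoly (σ : Perm n) : ℚ[X] := σ.cyclePoly / (1 - X)

theorem one_sub_X_ne_zero : (1 - X : ℚ[X]) ≠ 0 := by
  intro h
  simpa using congrArg (eval 0) h

theorem one_sub_X_mul_reducedCyclePoly [Nonempty n] (σ : Perm n) :
    (1 - X) * σ.reducedCyclePoly = σ.cyclePoly :=
  EuclideanDomain.mul_div_cancel' one_sub_X_ne_zero σ.one_sub_X_dvd_cyclePoly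

theorem reducedCyclePoly_one [Nonempty n] :
    (1 : Perm n).reducedCyclePoly = (1 - X) ^ (Fintype.card n - 1) := by
  apply mul_left_cancel₀ one_sub_X_ne_zero
  rw [one_sub_X_mul_reducedCyclePoly, cyclePoly_one, mul_pow_sub_one Fintype.card_ne_zero]

theorem sum_reducedCyclePoly_swap_mul [Nonempty n] (σ : Perm n) :
    ∑ τ : {τ : Perm n // τ.IsSwap}, (τ * σ).reducedCyclePoly =
      C ((Fintype.card n : ℚ) * (Fintype.card n - 1) / 2) * σ.reducedCyclePoly
        - C (Fintype.card n : ℚ) * X * derivative σ.reducedCyclePoly := by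
  have h1 := σ.sum_cyclePoly_swap_mul
  have h0 := sum_swap fun τ => (τ * σ).cyclePoly
  beta_reduce at h0
  rw [h0] at h1
  simp only [← one_sub_X_mul_reducedCyclePoly, ← Finset.mul_sum, one_mul, derivative_mul,
    derivative_sub, derivative_one, derivative_X, nsmul_eq_mul] at h1
  have h2 : (2 * (1 - X) * (1 - X) : ℚ[X]) ≠ 0 := by
    simp [one_sub_X_ne_zero]
  apply mul_left_cancel₀ h2
  have h3 : (2 : ℚ[X]) * C ((Fintype.card n : ℚ) * (Fintype.card n - 1) / 2)
      = Fintype.card n * (Fintype.card n - 1) := by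
    rw [← C_ofNat, ← C_mul, mul_div_cancel₀ _ (by norm_num)]
    simp
  have h4 : C (Fintype.card n : ℚ) = (Fintype.card n : ℚ[X]) := by simp
  rw [h4]
  push_cast at h1
  linear_combination h1 - (1 - X) * (1 - X) * σ.reducedCyclePoly * h3

theorem eval_one_reducedCyclePoly_of_not_sameCycle (σ : Perm n) {x y : n}
    (h : ¬ σ.SameCycle x y) : σ.reducedCyclePoly.eval 1 = 0 := by
  classical
  have : Nonempty n := ⟨x⟩
  have hinv (i : n) : σ.SameCycle x (σ i) ↔ σ.SameCycle x i := sameCycle_apply_right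
  have hdet := twoBlockTriangular_det σ.cycleMatrix (fun i => σ.SameCycle x i) (by
    intro i hi j hj
    rw [cycleMatrix_apply, if_neg, if_neg, sub_zero]
    · rintro rfl
      exact hi ((hinv i).1 hj)
    · rintro rfl
      exact hi hj)
  have hx : Nonempty {i // σ.SameCycle x i} := ⟨⟨x, SameCycle.refl _ _⟩⟩
  have hy : Nonempty {i // ¬ σ.SameCycle x i} := ⟨⟨y, h⟩⟩
  have key (p : n → Prop) [DecidablePred p] (hp : ∀ i, p (σ i) ↔ p i) [Nonempty {i // p i}] :
      1 - X ∣ (toSquareBlockProp σ.cycleMatrix p).det := by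
    apply dvd_det_of_row_sum
    rintro ⟨i, hi⟩
    have e1 (a : n) (ha : p a) (z : ℚ[X]) :
        ∑ j : {j // p j}, (if a = j then z else 0) = z := by
      rw [Finset.sum_eq_single ⟨a, ha⟩]
      · simp
      · rintro ⟨b, hb⟩ - hab
        exact if_neg fun hh => hab (Subtype.ext hh.symm)
      · simp
    simp only [toSquareBlockProp_def, of_apply, cycleMatrix_apply, Finset.sum_sub_distrib]
    rw [e1 i hi, e1 (σ i) ((hp i).2 hi)]
  obtain ⟨a, ha⟩ := key _ hinv
  obtain ⟨b, hb⟩ := key (fun i => ¬ σ.SameCycle x i) fun i => not_congr (hinv i)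
  have : σ.reducedCyclePoly = (1 - X) * a * b := by
    apply mul_left_cancel₀ one_sub_X_ne_zero
    rw [one_sub_X_mul_reducedCyclePoly, cyclePoly, hdet, ha, hb]
    ring
  simp [this]

theorem IsCycle.cyclePoly_eq {σ : Perm n} (hσ : σ.IsCycle) (hs : σ.support = univ) :
    σ.cyclePoly = 1 - X ^ Fintype.card n := by
  have hne (i : n) : σ i ≠ i := mem_support.1 (hs ▸ mem_univ i)
  have h1 : (1 : Perm n) ≠ σ⁻¹ := fun h => hσ.ne_one (inv_eq_one.1 h.symm)
  rw [cyclePoly, det_apply, ← Finset.sum_subset (Finset.subset_univ {1, σ⁻¹}),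
    Finset.sum_pair h1]
  · have e1 (i : n) : σ.cycleMatrix ((1 : Perm n) i) i = 1 := by
      simp [cycleMatrix_apply, hne]
    have e2 (i : n) : σ.cycleMatrix (σ⁻¹ i) i = - X := by
      have : σ (σ.symm i) ≠ σ.symm i := hne (σ⁻¹ i)
      rw [σ.apply_symm_apply i] at this
      change σ.cycleMatrix (σ.symm i) i = - X
      simp [cycleMatrix_apply, Ne.symm this]
    simp only [e1, e2, Finset.prod_const, hs, sign_one, sign_inv, hσ.sign, Finset.card_univ]
    rw [one_pow, one_smul, Units.smul_def, zsmul_eq_mul]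
    push_cast
    rw [neg_mul, ← mul_pow, neg_one_mul, neg_neg, sub_eq_add_neg]
  · intro π _ hπ
    simp only [mem_insert, mem_singleton, not_or] at hπ
    by_contra hprod
    have hπ' (i : n) : σ (π i) = i ∨ π i = i := by
      by_contra! hi
      refine hprod ?_
      rw [Finset.prod_eq_zero (mem_univ i), smul_zero]
      simp [cycleMatrix_apply, hi.1, hi.2]
    obtain ⟨i, hi⟩ : ∃ i, π i ≠ i := by
      by_contra! hall
      exact hπ.1 (Perm.ext hall)
    have hstep (j : n) (hj : π j ≠ j) : π j = σ⁻¹ j := by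
      rw [eq_inv_iff_eq]
      exact (hπ' j).resolve_right hj
    have hpow (k : ℕ) : π ((σ⁻¹ ^ k) i) ≠ (σ⁻¹ ^ k) i := by
      induction k with
      | zero => simpa using hi
      | succ k ih =>
        rw [pow_succ', mul_apply, ← hstep _ ih]
        exact fun h => ih (π.injective h)
    refine hπ.2 (Perm.ext fun j => hstep j ?_)
    obtain ⟨k, rfl⟩ := hσ.inv.exists_pow_eq (x := i) (y := j)
      (by rw [← mem_support, support_inv, hs]; exact mem_univ _)
      (by rw [← mem_support, support_inv, hs]; exact mem_univ _)
    exact hpow k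

theorem cycleType_eq_singleton_card_iff (hn : 2 ≤ Fintype.card n) (σ : Perm n) :
    σ.cycleType = {Fintype.card n} ↔ ∀ x y, σ.SameCycle x y := by
  constructor
  · intro h x y
    have hc : σ.IsCycle := card_cycleType_eq_one.1 (by simp [h])
    have hs : σ.support = univ := by
      rw [← Finset.card_eq_iff_eq_univ, ← sum_cycleType, h, Multiset.sum_singleton]
    exact hc.sameCycle (mem_support.1 (hs ▸ mem_univ x)) (mem_support.1 (hs ▸ mem_univ y))
  · intro h
    have : Nontrivial n := Fintype.one_lt_card_iff_nontrivial.1 hn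
    have hne (x : n) : σ x ≠ x := by
      intro hx
      obtain ⟨y, hy⟩ := exists_ne x
      exact hy ((h x y).eq_of_left hx).symm
    have hs : σ.support = univ := by
      ext x
      simp [hne]
    have hc : σ.IsCycle := by
      obtain ⟨x, -⟩ := exists_pair_ne n
      exact ⟨x, hne x, fun y _ => h x y⟩
    rw [hc.cycleType, hs, Finset.card_univ]

theorem eval_one_reducedCyclePoly (hn : 2 ≤ Fintype.card n) (σ : Perm n) :
    σ.reducedCyclePoly.eval 1 =
      if σ.cycleType = {Fintype.card n} then (Fintype.card n : ℚ) else 0 := by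
  have : Nonempty n := Fintype.card_pos_iff.1 (by omega)
  split_ifs with h
  · have hc : σ.IsCycle := card_cycleType_eq_one.1 (by simp [h])
    have hs : σ.support = univ := by
      rw [← Finset.card_eq_iff_eq_univ, ← sum_cycleType, h, Multiset.sum_singleton]
    have : σ.reducedCyclePoly = ∑ i ∈ range (Fintype.card n), X ^ i := by
      apply mul_left_cancel₀ one_sub_X_ne_zero
      rw [one_sub_X_mul_reducedCyclePoly, hc.cyclePoly_eq hs, mul_neg_geom_sum]
    simp [this, eval_finsetSum]
  · rw [cycleType_eq_singleton_card_iff hn] at h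
    push Not at h
    obtain ⟨x, y, hxy⟩ := h
    exact σ.eval_one_reducedCyclePoly_of_not_sameCycle hxy

end Equiv.Perm

namespace Equiv.Perm

variable {n : Type*} [Fintype n] [DecidableEq n]

theorem sum_reducedCyclePoly_prod_swaps [Nonempty n] (m : ℕ) :
    ∑ t : Fin m → {τ : Perm n // τ.IsSwap},
        (List.ofFn fun i => (t i : Perm n)).prod.reducedCyclePoly =
      ∑ k ∈ range (Fintype.card n), C ((-1) ^ k * ((Fintype.card n - 1).choose k : ℚ) *
        (Fintype.card n / 2 * ((Fintype.card n - 1 : ℕ) - 2 * k)) ^ m) * X ^ k := by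
  have hd : Fintype.card n - 1 + 1 = Fintype.card n := Nat.sub_add_cancel Fintype.card_pos
  have hd' : ((Fintype.card n - 1 : ℕ) : ℚ) = Fintype.card n - 1 := by
    rw [← hd]; simp
  induction m with
  | zero =>
    simp only [univ_unique, List.ofFn_zero, List.prod_nil, reducedCyclePoly_one, sum_const,
      card_singleton, one_smul, pow_zero, mul_one]
    rw [sub_eq_neg_add, add_pow, hd]
    refine Finset.sum_congr rfl fun k _ => ?_
    rw [neg_pow, one_pow, C_mul, C_pow, C_neg, C_1, C_eq_natCast]
    ring
  | succ m ih =>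
    rw [← (Fin.consEquiv fun _ => {τ : Perm n // τ.IsSwap}).sum_comp, Fintype.sum_prod_type_right]
    simp only [Fin.consEquiv, Equiv.coe_fn_mk, List.ofFn_succ, Fin.cons_zero, Fin.cons_succ,
      List.prod_cons, sum_reducedCyclePoly_swap_mul]
    rw [Finset.sum_sub_distrib, ← Finset.mul_sum, ← Finset.mul_sum, ← derivative_sum, ih,
      derivative_sum, Finset.mul_sum, Finset.mul_sum, ← Finset.sum_sub_distrib]
    refine Finset.sum_congr rfl fun k _ => ?_
    have hX : (X : ℚ[X]) * derivative (X ^ k) = C (k : ℚ) * X ^ k := by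
      cases k with
      | zero => simp
      | succ k => rw [derivative_X_pow, Nat.add_sub_cancel, pow_succ]; ring
    rw [derivative_C_mul, mul_assoc (C _) X, mul_left_comm X, hX, hd', ← mul_assoc, ← mul_assoc,
      ← mul_assoc, ← C_mul, ← C_mul, ← C_mul, ← sub_mul, ← C_sub]
    congr 2
    ring

theorem card_swap_factorizations_eq_of_isConj {σ ρ : Perm n} (h : IsConj σ ρ) (m : ℕ) :
    #{t : Fin m → {τ : Perm n // τ.IsSwap} | (List.ofFn fun i => (t i : Perm n)).prod = σ} =
      #{t : Fin m → {τ : Perm n // τ.IsSwap} | (List.ofFn fun i => (t i : Perm n)).prod = ρ} := by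
  obtain ⟨c, rfl⟩ := isConj_iff.1 h
  have hswap (τ : Perm n) : (MulAut.conj c τ).IsSwap ↔ τ.IsSwap := by
    rw [isSwap_iff_cycleType, isSwap_iff_cycleType, MulAut.conj_apply, cycleType_conj]
  let e : {τ : Perm n // τ.IsSwap} ≃ {τ : Perm n // τ.IsSwap} :=
    (MulAut.conj c).toEquiv.subtypeEquiv fun τ => (hswap τ).symm
  refine Finset.card_equiv (Equiv.piCongrRight fun _ => e) fun t => ?_
  have : (List.ofFn fun i => ((e (t i) : {τ : Perm n // τ.IsSwap}) : Perm n)).prod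
      = MulAut.conj c (List.ofFn fun i => (t i : Perm n)).prod := by
    rw [map_list_prod, List.map_ofFn]
    rfl
  simp only [mem_filter, mem_univ, true_and, Equiv.piCongrRight_apply, Pi.map_apply, this]
  rw [← MulAut.conj_apply, (MulAut.conj c).injective.eq_iff]

end Equiv.Perm

theorem Nfact_eq_card (d m : ℕ) :
    Nfact d m = #{t : Fin m → {τ : Perm (Fin d) // τ.IsSwap} |
      (List.ofFn fun i => (t i : Perm (Fin d))).prod = finRotate d} := by
  rw [Nfact, ← Fintype.card_subtype, ← Nat.card_eq_fintype_card]
  exact Nat.card_congr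
    { toFun := fun τ => ⟨fun i => ⟨τ.1 i, τ.2.1 i⟩, τ.2.2⟩
      invFun := fun t => ⟨fun i => t.1 i, fun i => (t.1 i).2, t.2⟩
      left_inv := fun _ => rfl
      right_inv := fun _ => rfl }

theorem factorial_mul_Nfact {d : ℕ} (hd : 2 ≤ d) (m : ℕ) :
    (d.factorial : ℚ) * Nfact d m =
      ∑ k ∈ range d, (-1) ^ k * ((d - 1).choose k : ℚ) * (d / 2 * ((d - 1 : ℕ) - 2 * k)) ^ m := by
  have : NeZero d := ⟨by omega⟩
  have h := congrArg (eval 1) (Perm.sum_reducedCyclePoly_prod_swaps (n := Fin d) m)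
  simp only [eval_finsetSum, Perm.eval_one_reducedCyclePoly (n := Fin d) (by simpa using hd),
    Fintype.card_fin, eval_mul, eval_C, eval_pow, eval_X, one_pow, mul_one] at h
  rw [← h, ← Finset.sum_fiberwise_of_maps_to (t := univ)
    (g := fun t : Fin m → {τ : Perm (Fin d) // τ.IsSwap} =>
      (List.ofFn fun i => (t i : Perm (Fin d))).prod) (fun _ _ => mem_univ _)]
  have key (σ : Perm (Fin d)) :
      ∑ t ∈ univ.filter (fun t : Fin m → {τ : Perm (Fin d) // τ.IsSwap} =>
        (List.ofFn fun i => (t i : Perm (Fin d))).prod = σ),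
        (if (List.ofFn fun i => (t i : Perm (Fin d))).prod.cycleType = {d} then (d : ℚ) else 0)
      = if σ.cycleType = {d} then (Nfact d m : ℚ) * d else 0 := by
    rw [Finset.sum_congr rfl (g := fun _ => if σ.cycleType = {d} then (d : ℚ) else 0)
      (fun t ht => by rw [(mem_filter.1 ht).2])]
    split_ifs with hσ
    · rw [Finset.sum_const, nsmul_eq_mul, Nfact_eq_card,
        Perm.card_swap_factorizations_eq_of_isConj (Perm.isConj_iff_cycleType_eq.2
          (hσ.trans (cycleType_finRotate_of_le hd).symm))]
    · simp
  simp only [key]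
  rw [← Finset.sum_filter, Finset.sum_const, Perm.card_of_cycleType_singleton hd (by simp),
    Fintype.card_fin, Nat.choose_self, mul_one, nsmul_eq_mul,
    ← Nat.mul_factorial_pred (by omega : d ≠ 0)]
  push_cast
  ring

namespace PowerSeries

/-- The even power series `(sinh X - X) / X ^ 3`. -/
noncomputable def sinhTail : ℚ⟦X⟧ :=
  mk fun n => if Even n then ((n + 3).factorial : ℚ)⁻¹ else 0

theorem exp_sub_evalNegHom_exp :
    exp ℚ - evalNegHom (exp ℚ) = C 2 * X * (1 + X ^ 2 * sinhTail) := by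
  have h : C 2 * X * (1 + X ^ 2 * sinhTail) = C (2 : ℚ) * (X ^ 1 + X ^ 3 * sinhTail) := by ring
  rw [h]
  ext n
  rw [coeff_C_mul, map_add, map_sub, evalNegHom, coeff_rescale, coeff_exp, coeff_X_pow,
    coeff_X_pow_mul', sinhTail]
  rcases n with _ | _ | _ | n
  · simp
  · norm_num
  · norm_num
  · rw [if_neg (by omega), if_pos (by omega), show n + 1 + 1 + 1 - 3 = n by omega, coeff_mk]
    rcases Nat.even_or_odd n with hn | hn
    · simp [hn, pow_add, hn.neg_one_pow]
      ring
    · simp [Nat.not_even_iff_odd.2 hn, pow_add, hn.neg_one_pow]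

theorem coeff_exp_sub_evalNegHom_exp_pow (n m : ℕ) :
    coeff m ((exp ℚ - evalNegHom (exp ℚ)) ^ n) =
      (∑ k ∈ range (n + 1), (-1) ^ k * (n.choose k : ℚ) * (n - 2 * k) ^ m) / m.factorial := by
  rw [sub_eq_neg_add, add_pow, map_sum, Finset.sum_div]
  refine Finset.sum_congr rfl fun k hk => ?_
  have hk' : k ≤ n := by simpa [Nat.lt_succ_iff] using hk
  have h1 : evalNegHom (exp ℚ) ^ k = rescale (-(k : ℚ)) (exp ℚ) := by
    rw [evalNegHom, ← map_pow, exp_pow_eq_rescale_exp, rescale_rescale]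
    congr 2
    ring
  have h2 : (-evalNegHom (exp ℚ)) ^ k * exp ℚ ^ (n - k) * (n.choose k : ℚ⟦X⟧)
      = C ((-1) ^ k * (n.choose k : ℚ)) * rescale ((n : ℚ) - 2 * k) (exp ℚ) := by
    rw [neg_pow, h1, exp_pow_eq_rescale_exp, mul_assoc ((-1) ^ k), exp_mul_exp_eq_exp_add]
    have e : -(k : ℚ) + (n - k : ℕ) = n - 2 * k := by push_cast [hk']; ring
    rw [e, map_mul, map_pow, map_neg, map_one, map_natCast]
    ring
  rw [h2, coeff_C_mul, coeff_rescale, coeff_exp]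
  simp
  ring

/-- The polynomial in `n` giving the coefficient of `X ^ (2 * g)` in `(sinh X / X) ^ n`. -/
noncomputable def sinhPowCoeff (g : ℕ) : ℚ[X] :=
  ∑ j ∈ range (g + 1),
    Polynomial.C (coeff (2 * g - 2 * j) (sinhTail ^ j) / j.factorial) * descPochhammer ℚ j

theorem eval_sinhPowCoeff (g n : ℕ) :
    (sinhPowCoeff g).eval (n : ℚ) = coeff (2 * g) ((1 + X ^ 2 * sinhTail) ^ n) := by
  have h1 : (sinhPowCoeff g).eval (n : ℚ) = ∑ j ∈ range (g + 1),
      (n.choose j : ℚ) * coeff (2 * g) ((X ^ 2 * sinhTail) ^ j) := by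
    rw [sinhPowCoeff, eval_finsetSum]
    refine Finset.sum_congr rfl fun j hj => ?_
    have hj' : 2 * j ≤ 2 * g := by simp at hj; omega
    rw [eval_mul, eval_C, descPochhammer_eval_eq_descFactorial,
      Nat.descFactorial_eq_factorial_mul_choose, mul_pow, ← pow_mul, coeff_X_pow_mul', if_pos hj']
    have := Nat.factorial_ne_zero j
    push_cast
    field_simp
  rw [h1, add_comm (1 : ℚ⟦X⟧), add_pow, map_sum]
  have h2 (j : ℕ) : coeff (2 * g) ((X ^ 2 * sinhTail) ^ j * 1 ^ (n - j) * (n.choose j : ℚ⟦X⟧))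
      = (n.choose j : ℚ) * coeff (2 * g) ((X ^ 2 * sinhTail) ^ j) := by
    rw [one_pow, mul_one, ← map_natCast (C (R := ℚ)), coeff_mul_C, mul_comm]
  simp only [h2]
  rw [Finset.sum_subset (range_subset_range.2 (by omega : g + 1 ≤ n + g + 1)),
    Finset.sum_subset (range_subset_range.2 (by omega : n + 1 ≤ n + g + 1))]
  · intro j _ hj
    rw [Nat.choose_eq_zero_of_lt (by simpa using hj), Nat.cast_zero, zero_mul]
  · intro j _ hj
    rw [mem_range] at hj
    rw [mul_pow, ← pow_mul, coeff_X_pow_mul', if_neg (by omega), mul_zero]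

theorem natDegree_sinhPowCoeff (g : ℕ) : (sinhPowCoeff g).natDegree = g := by
  have hc : constantCoeff sinhTail ≠ 0 := by
    rw [← coeff_zero_eq_constantCoeff_apply, sinhTail, coeff_mk]
    simp [Nat.factorial_ne_zero]
  have htop : coeff (2 * g - 2 * g) (sinhTail ^ g) / (g.factorial : ℚ) ≠ 0 := by
    rw [Nat.sub_self, coeff_zero_eq_constantCoeff_apply, map_pow]
    exact div_ne_zero (pow_ne_zero _ hc) (by exact_mod_cast g.factorial_ne_zero)
  have h1 : (Polynomial.C (coeff (2 * g - 2 * g) (sinhTail ^ g) / (g.factorial : ℚ)) *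
      descPochhammer ℚ g).degree = g := by
    rw [degree_C_mul htop, degree_eq_natDegree (monic_descPochhammer ℚ g).ne_zero,
      descPochhammer_natDegree]
  apply natDegree_eq_of_degree_eq_some
  rw [sinhPowCoeff, Finset.sum_range_succ, degree_add_eq_right_of_degree_lt, h1]
  rw [h1]
  refine (degree_sum_le _ _).trans_lt ?_
  refine (Finset.sup_lt_iff (WithBot.bot_lt_coe g)).2 fun j hj => ?_
  refine (degree_le_natDegree.trans (Nat.cast_le.2 (natDegree_C_mul_le _ _))).trans_lt ?_
  rw [descPochhammer_natDegree]
  exact WithBot.coe_lt_coe.2 (mem_range.1 hj)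

theorem sum_choose_mul_pow_eq (g n : ℕ) :
    (∑ k ∈ range (n + 1), (-1) ^ k * (n.choose k : ℚ) * (n - 2 * k) ^ (n + 2 * g)) =
      (n + 2 * g).factorial * 2 ^ n * (sinhPowCoeff g).eval (n : ℚ) := by
  have h := coeff_exp_sub_evalNegHom_exp_pow n (n + 2 * g)
  rw [exp_sub_evalNegHom_exp, mul_pow, mul_pow, ← map_pow, mul_assoc, coeff_C_mul,
    add_comm n (2 * g), coeff_X_pow_mul, ← eval_sinhPowCoeff, add_comm (2 * g) n] at h
  rw [mul_assoc, h, mul_div_cancel₀ _ (by exact_mod_cast Nat.factorial_ne_zero _)]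

end PowerSeries

theorem hurwitz_eq {g : ℕ} (hg : 1 ≤ g) {d : ℕ} (hd : 1 ≤ d) :
    hurwitz g d = (d : ℚ) ^ (d + 2 * g - 1) / (2 ^ (2 * g) * d.factorial) *
      (PowerSeries.sinhPowCoeff g).eval ((d : ℚ) - 1) := by
  obtain ⟨n, rfl⟩ : ∃ n, d = n + 1 := ⟨d - 1, by omega⟩
  have hm : n + 1 + 2 * g - 1 = n + 2 * g := by omega
  rw [hurwitz, hm]
  have hn : ((n + 1 : ℕ) : ℚ) - 1 = (n : ℚ) := by push_cast; ring
  rw [hn]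
  rcases Nat.eq_zero_or_pos n with rfl | hpos
  · have h0 : Nfact (0 + 1) (0 + 2 * g) = 0 := by
      have : IsEmpty {τ : Fin (0 + 2 * g) → Perm (Fin (0 + 1)) //
          (∀ i, (τ i).IsSwap) ∧ (List.ofFn τ).prod = finRotate (0 + 1)} := by
        refine ⟨fun τ => ?_⟩
        obtain ⟨a, b, hab, -⟩ := τ.2.1 ⟨0, by omega⟩
        exact hab (Subsingleton.elim (α := Fin 1) a b)
      exact Nat.card_of_isEmpty
    rw [h0, PowerSeries.eval_sinhPowCoeff, pow_zero, PowerSeries.coeff_one, if_neg (by omega)]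
    simp
  · have h := factorial_mul_Nfact (d := n + 1) (by omega) (n + 2 * g)
    simp only [Nat.add_sub_cancel, mul_pow ((n + 1 : ℕ) / 2 : ℚ)] at h
    simp only [mul_left_comm _ (((n + 1 : ℕ) / 2 : ℚ) ^ _), ← Finset.mul_sum] at h
    rw [PowerSeries.sum_choose_mul_pow_eq] at h
    have h1 : ((n + 1).factorial : ℚ) ≠ 0 := by exact_mod_cast Nat.factorial_ne_zero _
    have h2 : ((n + 2 * g).factorial : ℚ) ≠ 0 := by exact_mod_cast Nat.factorial_ne_zero _
    rw [div_eq_iff h2]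
    apply mul_left_cancel₀ h1
    rw [h, div_pow, pow_add 2 n]
    field_simp

/-- Polynomial structure of 1-part simple Hurwitz numbers: for every `g ≥ 1` there is a
polynomial `p_g ∈ ℚ[x]` of degree `3g−1` with `h_g(d) = (d^d/d!)·p_g(d)` for all `d ≥ 1`. -/
theorem one_part_hurwitz_polynomial (g : ℕ) (hg : 1 ≤ g) :
    ∃ p : Polynomial ℚ, p.natDegree = 3 * g - 1 ∧
      ∀ d : ℕ, 1 ≤ d →
        hurwitz g d = ((d : ℚ) ^ d / (d.factorial : ℚ)) * p.eval (d : ℚ) := by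
  refine ⟨C ((2 ^ (2 * g) : ℚ)⁻¹) * (X ^ (2 * g - 1) *
    (PowerSeries.sinhPowCoeff g).comp (X - C 1)), ?_, fun d hd => ?_⟩
  · have hdeg : ((PowerSeries.sinhPowCoeff g).comp (X - C 1)).natDegree = g := by
      rw [natDegree_comp, natDegree_X_sub_C, mul_one, PowerSeries.natDegree_sinhPowCoeff]
    have hne : (PowerSeries.sinhPowCoeff g).comp (X - C 1) ≠ 0 := by
      intro h
      rw [h, natDegree_zero] at hdeg
      omega
    rw [natDegree_C_mul (by positivity), natDegree_mul (pow_ne_zero _ X_ne_zero) hne,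
      natDegree_X_pow, hdeg]
    omega
  · rw [hurwitz_eq hg hd, show d + 2 * g - 1 = d + (2 * g - 1) by omega, pow_add]
    simp only [eval_mul, eval_C, eval_pow, eval_X, eval_comp, eval_sub]
    field_simp
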